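/- arXiv:2502.13528 — 2 statements merged into one kernel-verified Lean document; each statement's English description precedes it below -/
import Mathlib

section
/- Affine form of Proposition 4.6 (equivalence (1)⇔(3), the G_m case): let ω ∈ Ω¹_{A/k} be closed. Then the following are equivalent. (1) The connection d + ω on the rank-one free module A has vanishing p-curvature: for all k-derivations D, D' of A such that the underlying linear map of D' equals the p-th iterate of that of D, one has (D + ⟨ω,D⟩·)^p = D' + ⟨ω,D'⟩· as additive endomorphisms of A, where b· denotes multiplication by b. (2) ω is Zariski-locally logarithmic: for every prime ideal 𝔭 of A there exist g ∈ A ∖ 𝔭 and a unit f of the localization A_g such that the canonical image of ω in Ω¹_{A_g/k} equals f⁻¹·df. -/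
/-!
The `𝔾ₘ` case: for a closed `1`-form `ω`, the connection `d + ω` on the free rank-one module
`A` has vanishing `p`-curvature if and only if `ω` is Zariski-locally logarithmic.
-/

universe u

open TensorProduct in
/-- In characteristic `p`, the `p`-th iterate of a derivation is a derivation. -/
lemma Derivation.exists_eq_pow_char {k A : Type*} [Field k] (p : ℕ) [Fact p.Prime] [CharP k p]
    [CommRing A] [Algebra k A] (D : Derivation k A A) :
    ∃ D' : Derivation k A A, (D' : A →ₗ[k] A) = (D : A →ₗ[k] A) ^ p := by
  cases subsingleton_or_nontrivial A
  · exact ⟨0, Subsingleton.elim _ _⟩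
  have : CharP (Module.End k (A ⊗[k] A)) p :=
    charP_of_injective_algebraMap (algebraMap k _).injective p
  set D₀ : Module.End k A := (D : A →ₗ[k] A) with hD₀
  set S : Module.End k (A ⊗[k] A) := D₀.rTensor A
  set T : Module.End k (A ⊗[k] A) := D₀.lTensor A
  have hST : Commute S T := by
    refine TensorProduct.ext' fun a b ↦ ?_
    simp [S, T]
  have hmul (x : A ⊗[k] A) (n : ℕ) :
      LinearMap.mul' k A (((S + T) ^ n) x) = (D₀ ^ n) (LinearMap.mul' k A x) := by
    induction n generalizing x with
    | zero => simp
    | succ n ih =>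
      rw [pow_succ, pow_succ, Module.End.mul_apply, Module.End.mul_apply, ih]
      congr 1
      induction x with
      | zero => simp
      | tmul a b => simp [S, T, hD₀, mul_comm, add_comm]
      | add a b ha hb => rw [map_add, map_add, map_add, map_add, ha, hb]
  refine ⟨Derivation.mk' (D₀ ^ p) fun a b ↦ ?_, by ext; rfl⟩
  have h := hmul (a ⊗ₜ b) p
  rw [add_pow_char_of_commute p hST, LinearMap.mul'_apply] at h
  rw [← h]
  simp [S, T, LinearMap.rTensor_pow, LinearMap.lTensor_pow, mul_comm, add_comm]

/-- Around each prime, a finite projective module has a finite subfamily of a given spanning family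
with dual functionals, up to denominators. -/
lemma Module.exists_dual_family_of_projective {A M : Type u} [CommRing A] [AddCommGroup M]
    [Module A M] [Module.Finite A M] [Module.Projective A M] (P : Ideal A) [P.IsPrime]
    {σ : Type u} (v : σ → M) (hv : Submodule.span A (Set.range v) = ⊤) :
    ∃ (ι : Type u) (_ : Fintype ι) (_ : DecidableEq ι) (a : ι → σ) (l : ι → M →ₗ[A] A) (c s : A),
      c ∉ P ∧ s ∉ P ∧ (∀ i j, l i (v (a j)) = if i = j then c else 0) ∧
      ∀ m, ∃ r : ι → A, s • m = ∑ i, r i • v (a i) := by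
  classical
  have : Module.FinitePresentation A M := Module.finitePresentation_of_projective A M
  let R := Localization.AtPrime P
  let f := LocalizedModule.mkLinearMap P.primeCompl M
  have hspan : Submodule.span R (Set.range (f ∘ v)) = ⊤ := by
    rw [Set.range_comp]
    exact span_eq_top_of_isLocalizedModule R P.primeCompl f hv
  obtain ⟨ι, a, b, hb⟩ := Module.exists_basis_of_span_of_flat (R := R) (f ∘ v) hspan
  have : Finite ι := Module.Finite.finite_basis b
  have : Fintype ι := Fintype.ofFinite ι
  let g : (ι → A) →ₗ[A] (ι → R) := .pi fun i ↦ Algebra.linearMap A R ∘ₗ .proj i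
  let E : LocalizedModule P.primeCompl M →ₗ[A] (ι → R) :=
    b.equivFun.toLinearMap.restrictScalars A
  obtain ⟨L, t, hL⟩ := Module.FinitePresentation.exists_lift_of_isLocalizedModule P.primeCompl g
    (E ∘ₗ f)
  let B : (ι → A) →ₗ[A] M := Fintype.linearCombination A (v ∘ a)
  have hEB : (E ∘ₗ f) ∘ₗ B = g := by
    refine LinearMap.pi_ext' fun i ↦ LinearMap.ext_ring (funext fun j ↦ ?_)
    have : E (f (v (a i))) = Pi.single i 1 := by
      rw [← Function.comp_apply (f := f), ← hb]
      exact funext fun j ↦ (b.equivFun_self i j).trans (by simp [Pi.single_apply, eq_comm])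
    simp [B, g, Fintype.linearCombination_apply, this, Pi.single_apply]
  obtain ⟨s₁, hs₁⟩ := Module.Finite.exists_smul_of_comp_eq_of_isLocalizedModule P.primeCompl g
    (L ∘ₗ B) (t • LinearMap.id) (by
      rw [← LinearMap.comp_assoc, hL, LinearMap.smul_comp, hEB]
      ext; simp [Submonoid.smul_def])
  obtain ⟨s₂, hs₂⟩ := Module.Finite.exists_smul_of_comp_eq_of_isLocalizedModule P.primeCompl f
    (B ∘ₗ L) (t • LinearMap.id) (by
      refine LinearMap.ext fun m ↦ b.equivFun.injective ?_
      have h₁ := LinearMap.congr_fun hEB (L m)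
      have h₂ := LinearMap.congr_fun hL m
      change E (f (B (L m))) = E (f (t • m))
      rw [Submonoid.smul_def, map_smul, map_smul]
      exact h₁.trans h₂)
  refine ⟨ι, inferInstance, inferInstance, a, fun i ↦ LinearMap.proj i ∘ₗ (s₁ • L), s₁ * t,
    s₂ * t, (s₁ * t).2, (s₂ * t).2, fun i j ↦ ?_, fun m ↦ ⟨s₂.1 • L m, ?_⟩⟩
  · have := congr_fun (LinearMap.congr_fun hs₁ (Pi.single j 1)) i
    simpa [B, Fintype.linearCombination_apply, Pi.single_apply, Submonoid.smul_def] using this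
  · have := LinearMap.congr_fun hs₂ m
    simpa [B, Fintype.linearCombination_apply, Submonoid.smul_def, mul_smul, Finset.smul_sum]
      using this.symm

lemma Derivation.apply_pow_char {k A : Type*} [Field k] (p : ℕ) [CharP k p]
    [CommRing A] [Algebra k A] (D : Derivation k A A) (a : A) : D (a ^ p) = 0 := by
  rw [D.leibniz_pow, ← Nat.cast_smul_eq_nsmul k, CharP.cast_eq_zero, zero_smul]

/-- If `D s = 0`, the powers of `s • D` are those of `D` up to powers of `s`. -/
lemma Derivation.smul_pow_apply {k A : Type*} [CommRing k] [CommRing A] [Algebra k A]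
    (D : Derivation k A A) {s : A} (hs : D s = 0) (n : ℕ) (a : A) :
    (((s • D : Derivation k A A) : A →ₗ[k] A) ^ n) a = s ^ n * ((D : A →ₗ[k] A) ^ n) a := by
  induction n with
  | zero => simp
  | succ n ih =>
    rw [pow_succ' (_ : Module.End k A), pow_succ' (D : Module.End k A), Module.End.mul_apply,
      Module.End.mul_apply, ih]
    simp [D.leibniz_pow, hs]
    ring

lemma KaehlerDifferential.exists_smul_mem_span {k A : Type u} [CommRing k]
    [CommRing A] [Algebra k A] [Algebra.Smooth k A] (P : Ideal A) [P.IsPrime] :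
    ∃ (ι : Type u) (_ : Fintype ι) (_ : DecidableEq ι) (x : ι → A) (D : ι → Derivation k A A)
      (c s : A), c ∉ P ∧ s ∉ P ∧ (∀ i j, D i (x j) = if i = j then c else 0) ∧
      ∀ η : Ω[A⁄k], ∃ r : ι → A, s • η = ∑ i, r i • KaehlerDifferential.D k A (x i) := by
  obtain ⟨ι, h₁, h₂, x, l, c, s, hc, hs, hl, h⟩ := Module.exists_dual_family_of_projective P
    (KaehlerDifferential.D k A) (KaehlerDifferential.span_range_derivation k A)
  exact ⟨ι, h₁, h₂, x, fun i ↦ (l i).compDer (KaehlerDifferential.D k A), c, s, hc, hs, hl, h⟩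

/-- Around each prime, a smooth algebra in characteristic `p` has coordinates `x i` and commuting
derivations `D i` with `D i ^ p = 0` which are dual to each other up to a nonvanishing constant
`c`. -/
lemma Algebra.Smooth.exists_commuting_derivations {k A : Type u} [Field k] (p : ℕ)
    [Fact p.Prime] [CharP k p] [CommRing A] [Algebra k A] [Algebra.Smooth k A]
    (P : Ideal A) [P.IsPrime] :
    ∃ (ι : Type u) (_ : Fintype ι) (_ : DecidableEq ι) (x : ι → A) (D : ι → Derivation k A A)
      (c s : A), c ∉ P ∧ s ∉ P ∧ (∀ i j, D i (x j) = if i = j then c else 0) ∧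
      (∀ i, D i c = 0) ∧ (∀ i j, ⁅D i, D j⁆ = 0) ∧ (∀ i, (D i : A →ₗ[k] A) ^ p = 0) ∧
      ∀ η : Ω[A⁄k], ∃ r : ι → A, s • η = ∑ i, r i • KaehlerDifferential.D k A (x i) := by
  obtain ⟨ι, h₁, h₂, x, D, c, s, hc, hs, hD, h⟩ :=
    KaehlerDifferential.exists_smul_mem_span (k := k) P
  have hp : p ≠ 0 := (Fact.out : p.Prime).ne_zero
  have hp1 : p - 1 ≠ 0 := Nat.sub_ne_zero_of_lt (Fact.out : p.Prime).one_lt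
  have hkill (E : Derivation k A A) (hE : ∀ i, E (x i) = 0) (a : A) : s * E a = 0 := by
    obtain ⟨r, hr⟩ := h (KaehlerDifferential.D k A a)
    simpa [hE] using congrArg E.liftKaehlerDifferential hr
  let E (i : ι) : Derivation k A A := c ^ (p - 1) • D i
  have hE (i j : ι) : E i (x j) = if i = j then c ^ p else 0 := by
    simp [E, hD, ← pow_succ, Nat.sub_add_cancel (Nat.one_le_iff_ne_zero.mpr hp)]
  have hs0 (F : Derivation k A A) : F (s ^ p) = 0 := F.apply_pow_char p s
  have hc0 (F : Derivation k A A) : F (c ^ p) = 0 := F.apply_pow_char p c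
  refine ⟨ι, h₁, h₂, x, fun i ↦ s ^ p • E i, s ^ p * c ^ p, s, ?_, hs, fun i j ↦ ?_,
    fun i ↦ ?_, fun i j ↦ ?_, fun i ↦ ?_, h⟩
  · rw [← mul_pow]
    exact fun hmem ↦ ((‹P.IsPrime›.mem_or_mem (‹P.IsPrime›.mem_of_pow_mem _ hmem)).elim hs hc)
  · simp [hE]
  · simp [hs0, hc0]
  · ext a
    have h1 := hkill ⁅E i, E j⁆ (fun l ↦ by
      rw [Derivation.commutator_apply, hE, hE]
      split_ifs <;> simp [hc0]) a
    rw [Derivation.commutator_apply] at h1 ⊢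
    simp only [Derivation.smul_apply, Derivation.leibniz, smul_eq_mul, hs0, mul_zero, add_zero,
      Derivation.zero_apply]
    obtain ⟨q, rfl⟩ := Nat.exists_eq_succ_of_ne_zero hp
    rw [← mul_sub, ← mul_sub, pow_succ, mul_assoc (s ^ q), mul_left_comm s, h1]
    simp
  · ext a
    obtain ⟨F, hF⟩ := (E i).exists_eq_pow_char p
    rw [Derivation.smul_pow_apply _ (hs0 _), ← hF]
    have h1 := hkill F (fun l ↦ by
      change (F : A →ₗ[k] A) (x l) = 0
      obtain ⟨q, hq⟩ := Nat.exists_eq_succ_of_ne_zero hp1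
      obtain rfl : p = q + 2 := by omega
      rw [hF, pow_succ, pow_succ, Module.End.mul_apply, Module.End.mul_apply]
      simp only [Derivation.coeFn_coe, hE]
      split_ifs <;> simp [hc0]) a
    rw [← pow_mul]
    obtain ⟨q, hq⟩ := Nat.exists_eq_succ_of_ne_zero (mul_ne_zero hp hp)
    rw [hq, pow_succ, mul_assoc, Derivation.coeFn_coe, h1]
    simp

/-- If `∇ = D + w` is nilpotent on `e` and `D` has a coordinate `x`, then projecting an iterate of
`e` gives a horizontal element avoiding a given prime. -/
lemma Derivation.exists_horizontal {k A : Type*} [Field k] (p : ℕ) [Fact p.Prime] [CharP k p]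
    [CommRing A] [Algebra k A] (P : Ideal A) [P.IsPrime] (D : Derivation k A A) (w x c : A)
    (hx : D x = c) (hc : D c = 0) (hcP : c ∉ P)
    (Q : Submodule k A) (hQ : ∀ y ∈ Q, D y + w * y ∈ Q) (hQx : ∀ y ∈ Q, x * y ∈ Q)
    (hQc : ∀ y ∈ Q, c * y ∈ Q)
    (hnil : ((D : A →ₗ[k] A) + LinearMap.mulLeft k w) ^ p = 0)
    {e : A} (he : e ∈ Q) (heP : e ∉ P) :
    ∃ y ∈ Q, y ∉ P ∧ D y + w * y = 0 := by
  classical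
  set N : Module.End k A := (D : A →ₗ[k] A) + LinearMap.mulLeft k w with hN
  have hN_apply (y : A) : N y = D y + w * y := rfl
  have hNQ (n : ℕ) {y : A} (hy : y ∈ Q) : (N ^ n) y ∈ Q := by
    induction n with
    | zero => exact hy
    | succ n ih => rw [pow_succ', Module.End.mul_apply]; exact hQ _ ih
  -- the last iterate of `e` outside `P`
  obtain ⟨e, he, heP, hlast⟩ : ∃ e ∈ Q, e ∉ P ∧ ∀ n, n ≠ 0 → (N ^ n) e ∈ P := by
    have hex : ∃ n, ∀ m, n < m → (N ^ m) e ∈ P :=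
      by
      refine ⟨p, fun m hm ↦ ?_⟩
      obtain ⟨d, rfl⟩ := Nat.exists_eq_add_of_le hm.le
      simp [pow_add, hnil]
    refine ⟨(N ^ Nat.find hex) e, hNQ _ he, fun hmem ↦ ?_, fun n hn ↦ ?_⟩
    · rcases h0 : Nat.find hex with - | q
      · rw [h0] at hmem; exact heP hmem
      · refine Nat.find_min hex (m := q) (by omega) fun m hm ↦ ?_
        rcases (Nat.succ_le_of_lt hm).eq_or_lt with rfl | hlt
        · rwa [h0] at hmem
        · exact Nat.find_spec hex m (by omega)
    · rw [← Module.End.mul_apply, ← pow_add]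
      exact Nat.find_spec hex _ (by omega)
  obtain ⟨q, rfl⟩ := Nat.exists_eq_succ_of_ne_zero (Fact.out : p.Prime).ne_zero
  let b (j : ℕ) : k := (-1) ^ j * ((j.factorial : k))⁻¹
  let T (j : ℕ) : A := b j • (c ^ (q - j) * (x ^ j * (N ^ j) e))
  have hQpow (z : A) (hz : ∀ y ∈ Q, z * y ∈ Q) (n : ℕ) {y : A} (hy : y ∈ Q) : z ^ n * y ∈ Q := by
    induction n with
    | zero => simpa
    | succ n ih => rw [pow_succ', mul_assoc]; exact hz _ ih
  have hN_mul (y z : A) : N (y * z) = D y * z + y * N z := by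
    simp only [hN_apply, D.leibniz, smul_eq_mul]; ring
  have hb (j : ℕ) (hj : j + 1 ≤ q) : ((j : k) + 1) * b (j + 1) = - b j := by
    have h0 : ((j + 1 : ℕ) : k) ≠ 0 := fun h ↦ by
      have := Nat.le_of_dvd (Nat.succ_pos _) ((CharP.cast_eq_zero_iff k (q + 1) _).mp h)
      omega
    simp only [b, Nat.factorial_succ, Nat.cast_mul, mul_inv]
    push_cast at h0 ⊢
    field_simp
    ring
  have hsum (j : ℕ) (hj : j ≤ q) :
      N (∑ i ∈ Finset.range (j + 1), T i) = b j • (c ^ (q - j) * (x ^ j * (N ^ (j + 1)) e)) := by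
    induction j with
    | zero => simp [T, hN_mul, D.leibniz_pow, hc]
    | succ j ih =>
      obtain ⟨m, rfl⟩ := Nat.exists_eq_add_of_le hj
      have hstep : N (T (j + 1)) = (((j : k) + 1) * b (j + 1)) •
            (c ^ (m + 1) * (x ^ j * (N ^ (j + 1)) e)) +
          b (j + 1) • (c ^ m * (x ^ (j + 1) * (N ^ (j + 1 + 1)) e)) := by
        rw [pow_succ' N (j + 1), Module.End.mul_apply]
        simp only [T]
        rw [LinearMap.map_smul N, hN_mul, hN_mul, D.leibniz_pow, D.leibniz_pow, hc, hx]
        simp only [smul_eq_mul, nsmul_eq_mul, Algebra.smul_def (R := k), map_mul, map_add, map_one,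
          Nat.add_sub_cancel_left, Nat.add_sub_cancel]
        push_cast
        ring
      rw [Finset.sum_range_succ, map_add, ih (by omega), hstep, hb j hj,
        show j + 1 + m - j = m + 1 by omega, Nat.add_sub_cancel_left]
      simp
  refine ⟨∑ j ∈ Finset.range (q + 1), T j, ?_, ?_, ?_⟩
  · exact Q.sum_mem fun j _ ↦ Q.smul_mem _ (hQpow c hQc _ (hQpow x hQx _ (hNQ _ he)))
  · rw [Finset.sum_range_succ', P.add_mem_iff_right (P.sum_mem fun j _ ↦ ?_)]
    · intro hmem
      have h0 : c ^ q * e ∈ P := by simpa [T, b] using hmem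
      exact (‹P.IsPrime›.mem_or_mem h0).elim (fun h ↦ hcP (‹P.IsPrime›.mem_of_pow_mem _ h)) heP
    · exact P.smul_of_tower_mem _ (P.mul_mem_left _ (P.mul_mem_left _ (hlast _ j.succ_ne_zero)))
  · rw [← hN_apply, hsum q le_rfl, hnil]
    simp

/-- A closed form with vanishing `p`-curvature admits a horizontal section near each prime. -/
lemma exists_notMem_logarithmic {k A : Type u} [Field k] (p : ℕ)
    [Fact p.Prime] [CharP k p] [CommRing A] [Algebra k A] [Algebra.Smooth k A] (ω : Ω[A⁄k])
    (hclosed : ∀ D D' : Derivation k A A,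
      D (D'.liftKaehlerDifferential ω) - D' (D.liftKaehlerDifferential ω)
        - (⁅D, D'⁆ : Derivation k A A).liftKaehlerDifferential ω = 0)
    (hcurv : ∀ D : Derivation k A A, (D : A →ₗ[k] A) ^ p = 0 →
      ((D : A →ₗ[k] A) + LinearMap.mulLeft k (D.liftKaehlerDifferential ω)) ^ p = 0)
    (P : Ideal A) [P.IsPrime] :
    ∃ h ∉ P, ∃ g ∉ P, g • (KaehlerDifferential.D k A h + h • ω) = 0 := by
  obtain ⟨ι, _, _, x, D, c, s, hcP, hsP, hD, hDc, hcomm, hDp, hs⟩ :=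
    Algebra.Smooth.exists_commuting_derivations (k := k) p P
  let w (i : ι) : A := (D i).liftKaehlerDifferential ω
  have hNcomm (i j : ι) (y : A) :
      D i (D j y + w j * y) + w i * (D j y + w j * y) =
        D j (D i y + w i * y) + w j * (D i y + w i * y) := by
    have h1 := hclosed (D i) (D j)
    have h2 := DFunLike.congr_fun (hcomm i j) y
    rw [hcomm] at h1
    rw [Derivation.commutator_apply, Derivation.zero_apply] at h2
    have h3 : (0 : Derivation k A A).liftKaehlerDifferential ω = 0 :=
      LinearMap.congr_fun (map_zero (KaehlerDifferential.linearMapEquivDerivation k A).symm) ω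
    rw [h3, sub_zero] at h1
    simp only [map_add, Derivation.leibniz, smul_eq_mul]
    linear_combination h2 + y * h1
  have hhor (S : Finset ι) : ∃ y ∉ P, ∀ i ∈ S, D i y + w i * y = 0 := by
    induction S using Finset.induction_on with
    | empty => exact ⟨1, fun h ↦ ‹P.IsPrime›.ne_top ((P.eq_top_iff_one).mpr h), by simp⟩
    | insert j S hj ih =>
      obtain ⟨e, heP, he⟩ := ih
      let Q : Submodule k A :=
        ⨅ i ∈ S, LinearMap.ker ((D i : A →ₗ[k] A) + LinearMap.mulLeft k (w i))
      have hQ (y : A) : y ∈ Q ↔ ∀ i ∈ S, D i y + w i * y = 0 := by simp [Q]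
      have hQmul (z : A) (hz : ∀ i ∈ S, D i z = 0) (y : A) (hy : y ∈ Q) : z * y ∈ Q := by
        rw [hQ] at hy ⊢
        intro i hi
        rw [Derivation.leibniz, hz i hi]
        linear_combination z * hy i hi
      obtain ⟨y, hyQ, hyP, hy⟩ := (D j).exists_horizontal p P (w j) (x j) c (by simp [hD])
        (hDc j) hcP Q (fun y hy ↦ by
          rw [hQ] at hy ⊢
          intro i hi
          rw [hNcomm, hy i hi]
          simp) (hQmul _ fun i hi ↦ by
            rw [hD, if_neg]; rintro rfl; exact hj hi)
        (hQmul _ fun i _ ↦ hDc i) (hcurv _ (hDp j)) ((hQ e).mpr he) heP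
      exact ⟨y, hyP, Finset.forall_mem_insert _ _ _ |>.mpr ⟨hy, (hQ y).mp hyQ⟩⟩
  obtain ⟨h, hhP, hh⟩ := hhor Finset.univ
  refine ⟨h, hhP, c * s, fun hmem ↦ (‹P.IsPrime›.mem_or_mem hmem).elim hcP hsP, ?_⟩
  obtain ⟨r, hr⟩ := hs (KaehlerDifferential.D k A h + h • ω)
  have hcr (i : ι) : c * r i = 0 := by
    have h1 := congrArg (D i).liftKaehlerDifferential hr
    have h2 := hh i (Finset.mem_univ i)
    simp only [map_smul, map_add, Derivation.liftKaehlerDifferential_comp_D, map_sum, hD,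
      smul_eq_mul, mul_ite, mul_zero, Finset.sum_ite_eq, Finset.mem_univ, if_true] at h1
    linear_combination s * h2 - h1
  rw [mul_smul, hr, Finset.smul_sum]
  exact Finset.sum_eq_zero fun i _ ↦ by rw [smul_smul, hcr, zero_smul]

lemma KaehlerDifferential.exists_pow_smul_eq_zero {k A : Type u} [CommRing k] [CommRing A]
    [Algebra k A] (g : A) {η : Ω[A⁄k]}
    (h : KaehlerDifferential.map k k A (Localization.Away g) η = 0) : ∃ n : ℕ, g ^ n • η = 0 := by
  obtain ⟨⟨_, n, rfl⟩, hn⟩ := (IsLocalizedModule.eq_zero_iff (Submonoid.powers g)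
    (KaehlerDifferential.map k k A (Localization.Away g))).mp h
  exact ⟨n, hn⟩

lemma exists_unit_of_logarithmic {k A : Type u} [CommRing k] [CommRing A]
    [Algebra k A] (ω : Ω[A⁄k]) (h g : A)
    (hg : g • (KaehlerDifferential.D k A h + h • ω) = 0) :
    ∃ f : (Localization.Away (h * g))ˣ,
      KaehlerDifferential.map k k A (Localization.Away (h * g)) ω
        = ((f⁻¹ : (Localization.Away (h * g))ˣ) : Localization.Away (h * g)) •
            KaehlerDifferential.D k (Localization.Away (h * g))
              ((f : (Localization.Away (h * g))ˣ) : Localization.Away (h * g)) := by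
  set R := Localization.Away (h * g)
  have hu : IsUnit (algebraMap A R (h * g)) := IsLocalization.Away.algebraMap_isUnit _
  rw [map_mul, IsUnit.mul_iff] at hu
  obtain ⟨⟨u, hu⟩, ⟨v, hv⟩⟩ := hu
  have h1 := congrArg (KaehlerDifferential.map k k A R) hg
  rw [map_smul, map_add, map_smul, map_zero, KaehlerDifferential.map_D,
    ← algebraMap_smul R g, ← algebraMap_smul R h, ← hu, ← hv] at h1
  have h2 := congrArg (fun η ↦ (v⁻¹.1) • η) h1
  simp only [smul_smul, Units.inv_mul, one_smul, smul_zero] at h2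
  refine ⟨u⁻¹, ?_⟩
  rw [Derivation.leibniz_of_mul_eq_one _ (u.inv_mul), inv_inv, eq_neg_of_add_eq_zero_left h2]
  have h3 : u.1 * -u⁻¹.1 ^ 2 * u.1 = -1 := by
    linear_combination (-1 - u.1 * u⁻¹.1) * u.mul_inv
  rw [smul_neg, smul_neg, smul_smul, smul_smul, h3, neg_one_smul, neg_neg]

lemma pow_curvature_eq_of_locally_logarithmic {k A : Type u} [Field k] (p : ℕ)
    [Fact p.Prime] [CharP k p] [CommRing A] [Algebra k A] (ω : Ω[A⁄k]) (g : A)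
    (f : (Localization.Away g)ˣ)
    (hf : KaehlerDifferential.map k k A (Localization.Away g) ω
        = ((f⁻¹ : (Localization.Away g)ˣ) : Localization.Away g) •
            KaehlerDifferential.D k (Localization.Away g)
              ((f : (Localization.Away g)ˣ) : Localization.Away g))
    (D D' : Derivation k A A) (hDD' : (D' : A →ₗ[k] A) = (D : A →ₗ[k] A) ^ p) (y : A) :
    algebraMap A (Localization.Away g)
      ((((D : A →ₗ[k] A) + LinearMap.mulLeft k (D.liftKaehlerDifferential ω)) ^ p) y) =
    algebraMap A (Localization.Away g)
      (((D' : A →ₗ[k] A) + LinearMap.mulLeft k (D'.liftKaehlerDifferential ω)) y) := by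
  set R := Localization.Away g
  -- clear denominators by multiplying `f` by a `p`-th power
  obtain ⟨a, n, haf⟩ : ∃ (a : A) (n : ℕ), algebraMap A R a = algebraMap A R g ^ (p * n) * f := by
    obtain ⟨n, a, ha⟩ := IsLocalization.Away.surj g (f : R)
    obtain ⟨q, hq⟩ := Nat.exists_eq_succ_of_ne_zero (Fact.out : p.Prime).ne_zero
    refine ⟨g ^ (q * n) * a, n, ?_⟩
    change (f : R) * algebraMap A R g ^ n = algebraMap A R a at ha
    rw [map_mul, ← ha, hq, map_pow, Nat.succ_eq_add_one]
    ring
  have hgu : IsUnit (algebraMap A R g) := IsLocalization.Away.algebraMap_isUnit _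
  have hau : IsUnit (algebraMap A R a) := haf ▸ (hgu.pow _).mul f.isUnit
  obtain ⟨m, hm⟩ := KaehlerDifferential.exists_pow_smul_eq_zero (k := k) g
    (η := a • ω - KaehlerDifferential.D k A a) (by
      have h0 : KaehlerDifferential.D k R (algebraMap A R g ^ (p * n)) = 0 := by
        rw [mul_comm, pow_mul, Derivation.leibniz_pow, ← Nat.cast_smul_eq_nsmul k,
          CharP.cast_eq_zero, zero_smul]
      rw [map_sub, map_smul, KaehlerDifferential.map_D, hf, ← algebraMap_smul R a, haf,
        Derivation.leibniz, h0, smul_smul, mul_assoc]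
      simp)
  set G := g ^ (m * p) with hG
  have hGu : IsUnit (algebraMap A R G) := by rw [map_pow]; exact hgu.pow _
  have hDG : D G = 0 := by rw [hG, pow_mul, D.apply_pow_char p]
  have hlog (E : Derivation k A A) : G * E a = G * (a * E.liftKaehlerDifferential ω) := by
    have h1 := congrArg E.liftKaehlerDifferential hm
    simp only [map_smul, map_sub, smul_eq_mul, map_zero,
      Derivation.liftKaehlerDifferential_comp_D] at h1
    obtain ⟨q, hq⟩ := Nat.exists_eq_succ_of_ne_zero (Fact.out : p.Prime).ne_zero
    rw [hG, hq, Nat.succ_eq_add_one, mul_add_one, pow_add]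
    linear_combination - g ^ (m * q) * h1
  have hmul (E : Derivation k A A) (z : A) : G * E (a * z) =
      G * (a * ((E : A →ₗ[k] A) + LinearMap.mulLeft k (E.liftKaehlerDifferential ω)) z) := by
    simp only [E.leibniz, smul_eq_mul, LinearMap.add_apply, Derivation.coeFn_coe,
      LinearMap.mulLeft_apply]
    linear_combination z * hlog E
  set N : Module.End k A := (D : A →ₗ[k] A) + LinearMap.mulLeft k (D.liftKaehlerDifferential ω)
  have hpow (j : ℕ) : G * ((D : A →ₗ[k] A) ^ j) (a * y) = G * (a * (N ^ j) y) := by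
    induction j with
    | zero => simp
    | succ j ih =>
      have h1 := congrArg D ih
      simp only [D.leibniz, hDG, smul_eq_mul, mul_zero, add_zero] at h1
      rw [pow_succ' (D : Module.End k A), pow_succ' N, Module.End.mul_apply, Module.End.mul_apply,
        ← hmul, D.leibniz]
      exact h1
  have h2 := hpow p
  rw [← hDD', Derivation.coeFn_coe, hmul] at h2
  have h3 := congrArg (algebraMap A R) h2
  rw [map_mul, map_mul, map_mul _ G, map_mul _ a] at h3
  exact (hau.mul_left_cancel (hGu.mul_left_cancel h3)).symm

/-- **Rank-one forms with vanishing `p`-curvature are locally logarithmic.**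
Let `k` be a perfect field of characteristic `p` and `A` a smooth `k`-algebra. Let
`ω ∈ Ω¹_{A/k}` be closed. Then the connection `d + ω` on `A` has vanishing `p`-curvature
(i.e. `(D + ⟨ω,D⟩·)^p = D' + ⟨ω,D'⟩·` whenever `D'` equals the `p`-th iterate of `D`) if and
only if for every prime ideal `𝔭` of `A` there are `g ∉ 𝔭` and a unit `f` of `A_g` such that
the image of `ω` in `Ω¹_{A_g/k}` is `f⁻¹ • df`. -/
theorem rank_one_vanishing_p_curvature_iff_locally_logarithmic
    {k A : Type u} [Field k] [PerfectField k] (p : ℕ) [Fact p.Prime] [CharP k p]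
    [CommRing A] [Algebra k A] [Algebra.Smooth k A]
    (ω : Ω[A⁄k])
    (hclosed : ∀ D D' : Derivation k A A,
      D (D'.liftKaehlerDifferential ω) - D' (D.liftKaehlerDifferential ω)
        - (⁅D, D'⁆ : Derivation k A A).liftKaehlerDifferential ω = 0) :
    (∀ D D' : Derivation k A A, (D' : A →ₗ[k] A) = (D : A →ₗ[k] A) ^ p →
        ((D : A →ₗ[k] A) + LinearMap.mulLeft k (D.liftKaehlerDifferential ω)) ^ p
          = (D' : A →ₗ[k] A) + LinearMap.mulLeft k (D'.liftKaehlerDifferential ω))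
      ↔ (∀ P : Ideal A, P.IsPrime → ∃ g : A, g ∉ P ∧ ∃ f : (Localization.Away g)ˣ,
          KaehlerDifferential.map k k A (Localization.Away g) ω
            = ((f⁻¹ : (Localization.Away g)ˣ) : Localization.Away g) •
                KaehlerDifferential.D k (Localization.Away g)
                  ((f : (Localization.Away g)ˣ) : Localization.Away g)) := by
  refine ⟨fun hcurv P hP ↦ ?_, fun hlog D D' hDD' ↦ LinearMap.ext fun y ↦ ?_⟩
  · have hzero : (0 : Derivation k A A).liftKaehlerDifferential ω = 0 :=
      LinearMap.congr_fun (map_zero (KaehlerDifferential.linearMapEquivDerivation k A).symm) ω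
    obtain ⟨h, hhP, g, hgP, hg⟩ := exists_notMem_logarithmic p ω hclosed
      (fun D hD ↦ by rw [hcurv D 0 (by rw [hD]; rfl), hzero]; ext; simp) P
    exact ⟨h * g, fun hmem ↦ (hP.mem_or_mem hmem).elim hhP hgP,
      exists_unit_of_logarithmic ω h g hg⟩
  · rw [← sub_eq_zero]
    set z := (((D : A →ₗ[k] A) + LinearMap.mulLeft k (D.liftKaehlerDifferential ω)) ^ p) y -
      ((D' : A →ₗ[k] A) + LinearMap.mulLeft k (D'.liftKaehlerDifferential ω)) y with hz
    by_contra hne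
    let I : Ideal A := LinearMap.ker (LinearMap.toSpanSingleton A A z)
    have hI (b : A) : b ∈ I ↔ b * z = 0 := by simp [I]
    obtain ⟨P, hPmax, hIP⟩ := Ideal.exists_le_maximal I fun hI1 ↦ hne (by
      simpa using (hI 1).mp (hI1 ▸ Submodule.mem_top))
    obtain ⟨g, hgP, f, hf⟩ := hlog P hPmax.isPrime
    have h1 := pow_curvature_eq_of_locally_logarithmic p ω g f hf D D' hDD' y
    obtain ⟨⟨_, n, rfl⟩, hn⟩ := (IsLocalization.map_eq_zero_iff (Submonoid.powers g)
      (Localization.Away g) z).mp (by rw [hz, map_sub, h1, sub_self])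
    exact hgP (hPmax.isPrime.mem_of_pow_mem n (hIP ((hI _).mpr hn)))
end

section
/- Zariski-local nature of vanishing p-curvature (affine avatar of Lemma 2.12): let n ≥ 1 and let Ω be an n×n matrix with entries in Ω¹_{A/k}; for a k-derivation D of A write Ω(D) for the n×n matrix over A with entries ⟨Ω_{ij},D⟩, and let ∇_D(v) = D(v) + Ω(D)·v on Aⁿ (D applied entrywise). Assume ∇ is flat (∇_{[D,D']} = ∇_D∘∇_{D'} − ∇_{D'}∘∇_D for all k-derivations D, D' of A). Then ∇ has vanishing p-curvature ((∇_D)^p = ∇_{D'} whenever D' is a k-derivation whose underlying linear map equals the p-th iterate of that of D) if and only if for every prime ideal 𝔭 of A there exists g ∈ A ∖ 𝔭 such that the connection on (A_g)ⁿ defined by the matrix of canonical images of the entries of Ω in Ω¹_{A_g/k} has vanishing p-curvature (with respect to all k-derivations of A_g). -/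
/-!
Vanishing of the `p`-curvature of a flat matrix connection is a Zariski-local property.
-/

universe u

/-- The additive endomorphism `v ↦ D(v) + W · v` of `Aⁿ`: entrywise application of the
derivation `D` plus multiplication by the matrix `W`. -/
noncomputable def matConn {k A : Type*} [CommRing k] [CommRing A] [Algebra k A] {n : ℕ}
    (D : Derivation k A A) (W : Matrix (Fin n) (Fin n) A) : AddMonoid.End (Fin n → A) :=
  AddMonoidHom.mk' (fun v => (fun i => D (v i)) + W.mulVec v) (by
    intro v w
    simp only [Matrix.mulVec_add]
    funext i
    simp only [Pi.add_apply, map_add]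
    ring)

/-- Evaluation of a matrix of `1`-forms at a derivation, entrywise. -/
noncomputable def matOfForms {k A : Type*} [CommRing k] [CommRing A] [Algebra k A] {n : ℕ}
    (Ω : Matrix (Fin n) (Fin n) (Ω[A⁄k])) (D : Derivation k A A) :
    Matrix (Fin n) (Fin n) A :=
  fun i j => D.liftKaehlerDifferential (Ω i j)

section Naturality

variable {k A B : Type*} [CommRing k] [CommRing A] [CommRing B] [Algebra k A] [Algebra k B]
  [Algebra A B] {n : ℕ}

theorem liftKaehlerDifferential_map [IsScalarTower k A B] {D : Derivation k A A} {E : Derivation k B B}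
    (h : ∀ a, E (algebraMap A B a) = algebraMap A B (D a)) (ω : Ω[A⁄k]) :
    E.liftKaehlerDifferential (KaehlerDifferential.map k k A B ω)
      = algebraMap A B (D.liftKaehlerDifferential ω) := by
  suffices H : (E.liftKaehlerDifferential.restrictScalars A).comp (KaehlerDifferential.map k k A B)
      = (Algebra.linearMap A B).comp D.liftKaehlerDifferential from LinearMap.congr_fun H ω
  apply Derivation.liftKaehlerDifferential_unique
  ext a
  simp [h]

theorem matConn_apply (D : Derivation k A A) (W : Matrix (Fin n) (Fin n) A) (v : Fin n → A)
    (i : Fin n) : matConn D W v i = D (v i) + W.mulVec v i :=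
  rfl

theorem matConn_algebraMap [IsScalarTower k A B] {D : Derivation k A A} {E : Derivation k B B}
    (h : ∀ a, E (algebraMap A B a) = algebraMap A B (D a))
    (Ω : Matrix (Fin n) (Fin n) (Ω[A⁄k])) (v : Fin n → A) :
    matConn E (matOfForms (fun i j => KaehlerDifferential.map k k A B (Ω i j)) E)
        (algebraMap A B ∘ v)
      = algebraMap A B ∘ matConn D (matOfForms Ω D) v := by
  funext i
  simp [matConn_apply, matOfForms, Matrix.mulVec, dotProduct, h, liftKaehlerDifferential_map h]

theorem matConn_pow_algebraMap [IsScalarTower k A B] {D : Derivation k A A} {E : Derivation k B B}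
    (h : ∀ a, E (algebraMap A B a) = algebraMap A B (D a))
    (Ω : Matrix (Fin n) (Fin n) (Ω[A⁄k])) (m : ℕ) (v : Fin n → A) :
    (matConn E (matOfForms (fun i j => KaehlerDifferential.map k k A B (Ω i j)) E) ^ m)
        (algebraMap A B ∘ v)
      = algebraMap A B ∘ (matConn D (matOfForms Ω D) ^ m) v := by
  induction m generalizing v with
  | zero => rfl
  | succ m ih =>
    simp only [pow_succ, AddMonoid.End.coe_mul, Function.comp_apply (g := DFunLike.coe _),
      matConn_algebraMap h, ih]

theorem derivation_pow_algebraMap {D : Derivation k A A} {E : Derivation k B B}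
    (h : ∀ a, E (algebraMap A B a) = algebraMap A B (D a)) (m : ℕ) (a : A) :
    ((E : B →ₗ[k] B) ^ m) (algebraMap A B a) = algebraMap A B (((D : A →ₗ[k] A) ^ m) a) := by
  induction m generalizing a with
  | zero => rfl
  | succ m ih =>
    rw [pow_succ, pow_succ, Module.End.mul_apply, Module.End.mul_apply, Derivation.coeFn_coe,
      Derivation.coeFn_coe, h, ih]

/-- Derivations extend along localizations. -/
theorem exists_derivation_extending [IsScalarTower k A B] (M : Submonoid A)
    [IsLocalization M B] (D : Derivation k A A) :
    ∃ E : Derivation k B B, ∀ a, E (algebraMap A B a) = algebraMap A B (D a) := by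
  have hb : IsBaseChange B (KaehlerDifferential.map k k A B) :=
    (isLocalizedModule_iff_isBaseChange M B _).mp inferInstance
  refine ⟨(hb.lift ((Algebra.linearMap A B).comp D.liftKaehlerDifferential)).compDer
    (KaehlerDifferential.D k B), fun a => ?_⟩
  have := hb.lift_eq ((Algebra.linearMap A B).comp D.liftKaehlerDifferential)
    (KaehlerDifferential.D k A a)
  simpa using this

theorem derivation_pow_char (p : ℕ) [CharP k p] (D : Derivation k A A) (t : A) :
    D (t ^ p) = 0 := by
  rw [Derivation.leibniz_pow, ← Nat.cast_smul_eq_nsmul k, CharP.cast_eq_zero, zero_smul]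

/-- A derivation in characteristic `p` is linear over `p`-th powers, and so are its iterates. -/
theorem derivation_pow_pow_char_mul (p : ℕ) [CharP k p] (D : Derivation k A A) (m : ℕ)
    (t a : A) :
    ((D : A →ₗ[k] A) ^ m) (t ^ p * a) = t ^ p * ((D : A →ₗ[k] A) ^ m) a := by
  induction m generalizing a with
  | zero => rfl
  | succ m ih =>
    rw [pow_succ, Module.End.mul_apply, Module.End.mul_apply, ← ih,
      Derivation.coeFn_coe, Derivation.leibniz, derivation_pow_char, smul_zero, add_zero, smul_eq_mul]

/-- If `D'` is the `p`-th iterate of `D` in characteristic `p`, the same holds for their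
extensions to a localization. -/
theorem derivation_eq_pow_of_isLocalization (M : Submonoid A) [IsLocalization M B]
    (p : ℕ) [Fact p.Prime] [CharP k p] {D D' : Derivation k A A} {E E' : Derivation k B B}
    (h : ∀ a, E (algebraMap A B a) = algebraMap A B (D a))
    (h' : ∀ a, E' (algebraMap A B a) = algebraMap A B (D' a))
    (hD : (D' : A →ₗ[k] A) = (D : A →ₗ[k] A) ^ p) :
    (E' : B →ₗ[k] B) = (E : B →ₗ[k] B) ^ p := by
  ext b
  obtain ⟨⟨a, s⟩, hs⟩ := IsLocalization.surj M b
  have hu : IsUnit (algebraMap A B s ^ p) := (IsLocalization.map_units B s).pow p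
  have hb : algebraMap A B s ^ p * b = algebraMap A B (s ^ (p - 1) * a) := by
    rw [map_mul, ← hs, map_pow, ← pow_sub_one_mul (Fact.out : p.Prime).ne_zero]
    ring
  apply hu.mul_left_cancel
  rw [← derivation_pow_pow_char_mul, hb, derivation_pow_algebraMap h, ← hD,
    Derivation.coeFn_coe, Derivation.coeFn_coe, ← h', ← hb,
    Derivation.leibniz, derivation_pow_char, smul_zero, add_zero, smul_eq_mul]

/-- A derivation of `B` descends along a bijective algebra map. -/
theorem exists_derivation_of_bijective [IsScalarTower k A B]
    (hφ : Function.Bijective (algebraMap A B))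
    (E : Derivation k B B) :
    ∃ D : Derivation k A A, ∀ a, E (algebraMap A B a) = algebraMap A B (D a) := by
  let e : A ≃ₐ[k] B := AlgEquiv.ofBijective (IsScalarTower.toAlgHom k A B) hφ
  have he (a : A) : e a = algebraMap A B a := rfl
  refine ⟨Derivation.mk' (e.symm.toLinearMap ∘ₗ (E : B →ₗ[k] B) ∘ₗ e.toLinearMap)
    fun a b => e.injective ?_, fun a => ?_⟩
  · simp
  · simp [← he]

end Naturality

/-- **Vanishing `p`-curvature is Zariski-local.**
Let `k` be a perfect field of characteristic `p`, `A` a smooth `k`-algebra, `n ≥ 1` and `Ω`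
an `n × n` matrix of `1`-forms such that the connection `∇_D v = D(v) + Ω(D) · v` on `Aⁿ` is
flat. Then `∇` has vanishing `p`-curvature if and only if for every prime ideal `𝔭` of `A`
there is `g ∉ 𝔭` such that the connection on `(A_g)ⁿ` defined by the image of `Ω` in
`Ω¹_{A_g/k}` has vanishing `p`-curvature with respect to all `k`-derivations of `A_g`. -/
theorem vanishing_p_curvature_is_zariski_local
    {k A : Type u} [Field k] [PerfectField k] (p : ℕ) [Fact p.Prime] [CharP k p]
    [CommRing A] [Algebra k A] [Algebra.Smooth k A]
    (n : ℕ) (hn : 1 ≤ n) (Ω : Matrix (Fin n) (Fin n) (Ω[A⁄k]))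
    (flat : ∀ D D' : Derivation k A A,
      matConn (⁅D, D'⁆ : Derivation k A A) (matOfForms Ω ⁅D, D'⁆)
        = matConn D (matOfForms Ω D) * matConn D' (matOfForms Ω D')
          - matConn D' (matOfForms Ω D') * matConn D (matOfForms Ω D)) :
    (∀ D D' : Derivation k A A, (D' : A →ₗ[k] A) = (D : A →ₗ[k] A) ^ p →
        matConn D (matOfForms Ω D) ^ p = matConn D' (matOfForms Ω D'))
    ↔ (∀ P : Ideal A, P.IsPrime → ∃ g : A, g ∉ P ∧
        ∀ D' E' : Derivation k (Localization.Away g) (Localization.Away g),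
          (E' : Localization.Away g →ₗ[k] Localization.Away g)
              = (D' : Localization.Away g →ₗ[k] Localization.Away g) ^ p →
          matConn D' (matOfForms
              (fun i j => KaehlerDifferential.map k k A (Localization.Away g) (Ω i j)) D') ^ p
            = matConn E' (matOfForms
              (fun i j => KaehlerDifferential.map k k A (Localization.Away g) (Ω i j)) E')) := by
  constructor
  · intro H P hP
    refine ⟨1, P.one_notMem, fun D' E' hE => ?_⟩
    have hφ : Function.Bijective (algebraMap A (Localization.Away (1 : A))) :=
      (IsLocalization.atUnit A (Localization.Away (1 : A)) 1 isUnit_one).bijective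
    obtain ⟨D, hD⟩ := exists_derivation_of_bijective hφ D'
    obtain ⟨E, hE'⟩ := exists_derivation_of_bijective hφ E'
    have hDE : (E : A →ₗ[k] A) = (D : A →ₗ[k] A) ^ p := by
      ext a
      apply hφ.injective
      rw [← derivation_pow_algebraMap hD, ← hE, Derivation.coeFn_coe, Derivation.coeFn_coe, hE']
    ext1 w
    obtain ⟨v, rfl⟩ := hφ.surjective.comp_left w
    rw [matConn_pow_algebraMap hD, matConn_algebraMap hE', H D E hDE]
  · intro H D D' hD
    ext v i
    set x := (matConn D (matOfForms Ω D) ^ p) v i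
    set y := matConn D' (matOfForms Ω D') v i
    let I : Ideal A := (⊥ : Ideal A).colon {x - y}
    suffices hI : I = ⊤ by
      have h1 : (1 : A) ∈ I := hI ▸ Submodule.mem_top
      simpa [I, Submodule.mem_colon_singleton, sub_eq_zero] using h1
    by_contra hI
    obtain ⟨P, hP, hIP⟩ := Ideal.exists_le_maximal I hI
    obtain ⟨g, hg, hpc⟩ := H P hP.isPrime
    obtain ⟨E, hE⟩ := exists_derivation_extending (B := Localization.Away g) (.powers g) D
    obtain ⟨E', hE'⟩ := exists_derivation_extending (B := Localization.Away g) (.powers g) D'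
    have key := hpc E E' (derivation_eq_pow_of_isLocalization (.powers g) p hE hE' hD)
    have hv := congr_fun (DFunLike.congr_fun key (algebraMap A (Localization.Away g) ∘ v)) i
    rw [matConn_pow_algebraMap hE, matConn_algebraMap hE'] at hv
    obtain ⟨⟨_, m, rfl⟩, hc⟩ := (IsLocalization.eq_iff_exists (.powers g) _).mp hv
    refine hg (hP.isPrime.mem_of_pow_mem m (hIP ?_))
    rw [Submodule.mem_colon_singleton, Submodule.mem_bot, smul_eq_mul, mul_sub, sub_eq_zero]
    exact hc
end
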